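/- Let d ≥ 1, α ∈ (0,1], and s > 0. There exists a constant C > 0 such that for every Schwartz function g : ℝ^d → ℂ and every real R > 0, ‖g‖_{L²(ℝ^d)} ≤ C ( R^{αd/(2(2−α))} ‖g‖_{L^{2−α}(ℝ^d)} + R^{−s} ( ∫_{ℝ^d} |ξ|^{2s} |𝓕g(ξ)|² dξ )^{1/2} ). -/

import Mathlib

open MeasureTheory FourierTransform

/-- Hölder's inequality against a bounded square-integrable function: the conjugate norm is
interpolated between the sup norm and the `L²` norm. -/
lemma integral_norm_mul_norm_le_of_bounded {X : Type*} [MeasurableSpace X] {μ : Measure X}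
    {f h : X → ℂ} {p θ β M : ℝ} (hp : 0 < p) (hθ : 0 ≤ θ) (hβ : 0 ≤ β)
    (hpβ : p⁻¹ + β = 1) (hθβ : θ + 2 * β = 1)
    (hf : MemLp f (ENNReal.ofReal p) μ) (hh : MemLp h 2 μ) (hM : ∀ x, ‖h x‖ ≤ M) (hM0 : 0 ≤ M) :
    ∫ x, ‖f x‖ * ‖h x‖ ∂μ ≤
      (eLpNorm f (ENNReal.ofReal p) μ).toReal * M ^ θ * (∫ x, ‖h x‖ ^ 2 ∂μ) ^ β := by
  have hnorm : eLpNorm f (ENNReal.ofReal p) μ = (∫⁻ x, ‖f x‖ₑ ^ p ∂μ) ^ p⁻¹ := by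
    rw [eLpNorm_eq_lintegral_rpow_enorm_toReal (by simpa using hp) (by simp),
      ENNReal.toReal_ofReal hp.le, one_div]
  have hh2 : Integrable (fun x => ‖h x‖ ^ 2) μ := hh.integrable_norm_pow (by norm_num)
  have hsq : ∫⁻ x, ‖h x‖ₑ ^ (2 : ℝ) ∂μ = ENNReal.ofReal (∫ x, ‖h x‖ ^ 2 ∂μ) := by
    rw [ofReal_integral_eq_lintegral_ofReal hh2 (ae_of_all _ fun x => by positivity)]
    refine lintegral_congr fun x => ?_
    rw [ENNReal.ofReal_pow (norm_nonneg _), ofReal_norm, ENNReal.rpow_two]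
  have hpt : ∀ x, ‖f x‖ₑ * ‖h x‖ₑ ≤
      ENNReal.ofReal M ^ θ * ((‖f x‖ₑ ^ p) ^ p⁻¹ * (‖h x‖ₑ ^ (2 : ℝ)) ^ β) := by
    intro x
    have h1 : ‖h x‖ₑ = ‖h x‖ₑ ^ θ * (‖h x‖ₑ ^ (2 : ℝ)) ^ β := by
      rw [← ENNReal.rpow_mul, ← ENNReal.rpow_add_of_nonneg _ _ hθ (by positivity), hθβ,
        ENNReal.rpow_one]
    have h2 : ‖h x‖ₑ ≤ ENNReal.ofReal M := by
      rw [← ofReal_norm]; exact ENNReal.ofReal_le_ofReal (hM x)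
    rw [← ENNReal.rpow_mul ‖f x‖ₑ, mul_inv_cancel₀ hp.ne', ENNReal.rpow_one]
    calc ‖f x‖ₑ * ‖h x‖ₑ = ‖f x‖ₑ * (‖h x‖ₑ ^ θ * (‖h x‖ₑ ^ (2 : ℝ)) ^ β) := by rw [← h1]
      _ ≤ ‖f x‖ₑ * (ENNReal.ofReal M ^ θ * (‖h x‖ₑ ^ (2 : ℝ)) ^ β) := by gcongr
      _ = _ := by ring
  have key : ∫⁻ x, ‖f x‖ₑ * ‖h x‖ₑ ∂μ ≤ ENNReal.ofReal M ^ θ *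
      (eLpNorm f (ENNReal.ofReal p) μ * ENNReal.ofReal (∫ x, ‖h x‖ ^ 2 ∂μ) ^ β) := by
    refine (lintegral_mono hpt).trans ?_
    rw [lintegral_const_mul' _ _ (ENNReal.rpow_ne_top_of_nonneg hθ ENNReal.ofReal_ne_top),
      hnorm, ← hsq]
    gcongr
    exact ENNReal.lintegral_mul_norm_pow_le (hf.1.enorm.pow_const p) (hh.1.enorm.pow_const 2)
      (by positivity) hβ hpβ
  have hI : 0 ≤ ∫ x, ‖h x‖ ^ 2 ∂μ := integral_nonneg fun x => by positivity
  rw [integral_eq_lintegral_of_nonneg_ae (ae_of_all _ fun x => by positivity)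
    (by exact hf.1.norm.mul hh.1.norm)]
  refine ENNReal.toReal_le_of_le_ofReal (by positivity) ?_
  simp_rw [ENNReal.ofReal_mul (norm_nonneg _), ofReal_norm]
  refine key.trans_eq ?_
  rw [ENNReal.ofReal_mul (by positivity), ENNReal.ofReal_mul (by positivity),
    ENNReal.ofReal_toReal hf.2.ne, ENNReal.ofReal_rpow_of_nonneg hM0 hθ,
    ENNReal.ofReal_rpow_of_nonneg hI hβ]
  ring

/-- Cauchy–Schwarz with a nonnegative weight. -/
lemma sq_integral_mul_le_integral_mul_integral {X : Type*} [MeasurableSpace X] {μ : Measure X}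
    {φ u : X → ℝ} (hφ : ∀ x, 0 ≤ φ x) (h0 : Integrable φ μ)
    (h1 : Integrable (fun x => φ x * u x) μ) (h2 : Integrable (fun x => φ x * u x ^ 2) μ) :
    (∫ x, φ x * u x ∂μ) ^ 2 ≤ (∫ x, φ x ∂μ) * ∫ x, φ x * u x ^ 2 ∂μ := by
  have h : ∀ m : ℝ, 0 ≤ (∫ x, φ x ∂μ) * (m * m) + (-2 * ∫ x, φ x * u x ∂μ) * m +
      ∫ x, φ x * u x ^ 2 ∂μ := by
    intro m
    have : 0 ≤ ∫ x, (φ x * (m * m) + φ x * u x * (-2 * m)) + φ x * u x ^ 2 ∂μ :=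
      integral_nonneg fun x => by
        have := mul_nonneg (hφ x) (sq_nonneg (u x - m))
        simp only [Pi.zero_apply]
        linarith
    rw [integral_add (by exact (h0.mul_const _).add (h1.mul_const _)) h2,
      integral_add (h0.mul_const _) (h1.mul_const _), integral_mul_const,
      integral_mul_const] at this
    linarith
  have := discrim_le_zero h
  rw [discrim] at this
  linarith

section Schwartz

variable {V : Type*} [NormedAddCommGroup V] [InnerProductSpace ℝ V] [FiniteDimensional ℝ V]
  [MeasurableSpace V] [BorelSpace V]

lemma SchwartzMap.integrable_norm_sq (g : SchwartzMap V ℂ) : Integrable fun x => ‖g x‖ ^ 2 :=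
  (g.memLp 2 volume).integrable_norm_pow (by norm_num)

lemma SchwartzMap.integrable_norm_rpow_mul_norm_sq (g : SchwartzMap V ℂ) {t : ℝ} (ht : 0 ≤ t) :
    Integrable fun x => ‖x‖ ^ t * ‖g x‖ ^ 2 := by
  obtain ⟨B, hB⟩ : ∃ B, ∀ x, ‖g x‖ ≤ B :=
    ⟨_, fun x => by simpa using SchwartzMap.norm_le_seminorm ℝ g x⟩
  have hint := (g.integrable_norm_sq).add ((g.integrable_pow_mul volume ⌈t⌉₊).mul_const B)
  refine hint.mono' ?_ (ae_of_all _ fun x => ?_)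
  · exact ((continuous_norm.rpow_const fun _ => Or.inr ht).mul
      (g.continuous.norm.pow 2)).aestronglyMeasurable
  · have h1 : ‖x‖ ^ t ≤ 1 + ‖x‖ ^ ⌈t⌉₊ := by
      rcases le_total ‖x‖ 1 with hx | hx
      · have := Real.rpow_le_one (norm_nonneg x) hx ht
        have := pow_nonneg (norm_nonneg x) ⌈t⌉₊
        linarith
      · have := Real.rpow_le_rpow_of_exponent_le hx (Nat.le_ceil t)
        rw [Real.rpow_natCast] at this
        linarith
    rw [Real.norm_of_nonneg (by positivity)]
    calc ‖x‖ ^ t * ‖g x‖ ^ 2 ≤ (1 + ‖x‖ ^ ⌈t⌉₊) * ‖g x‖ ^ 2 := by gcongr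
      _ = ‖g x‖ ^ 2 + ‖x‖ ^ ⌈t⌉₊ * ‖g x‖ * ‖g x‖ := by ring
      _ ≤ ‖g x‖ ^ 2 + ‖x‖ ^ ⌈t⌉₊ * ‖g x‖ * B := by gcongr; exact hB x

lemma SchwartzMap.norm_fourierInv_le_integral_norm (f : SchwartzMap V ℂ) (x : V) :
    ‖(𝓕⁻ f) x‖ ≤ ∫ v, ‖f v‖ := by
  rw [SchwartzMap.fourierInv_coe, Real.fourierInv_eq]
  refine (norm_integral_le_integral_norm _).trans_eq ?_
  simp

/-- A smooth frequency cutoff maps `L^p` to `L²`, with the constant of Bernstein's inequality. -/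
lemma sqrt_integral_mul_norm_fourier_sq_le (g : SchwartzMap V ℂ) {φ : V → ℝ}
    (hφs : ContDiff ℝ (⊤ : ℕ∞) φ) (hφc : HasCompactSupport φ) (hφ0 : ∀ ξ, 0 ≤ φ ξ) (hφ1 : ∀ ξ, φ ξ ≤ 1)
    {p θ β : ℝ} (hp : 0 < p) (hθ : 0 ≤ θ) (hβ : 0 ≤ β)
    (hpβ : p⁻¹ + β = 1) (hθβ : θ + 2 * β = 1) :
    √(∫ ξ, φ ξ * ‖(𝓕 g) ξ‖ ^ 2) ≤
      (eLpNorm g (ENNReal.ofReal p) volume).toReal * √(∫ ξ, φ ξ) ^ θ := by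
  have hcs : HasCompactSupport fun ξ => (φ ξ : ℂ) * (𝓕 g) ξ :=
    (hφc.comp_left (g := ((↑) : ℝ → ℂ)) Complex.ofReal_zero).mul_right
  have hcd : ContDiff ℝ (⊤ : ℕ∞) fun ξ => (φ ξ : ℂ) * (𝓕 g) ξ :=
    (Complex.ofRealCLM.contDiff.comp hφs).mul ((𝓕 g).smooth _)
  set k : SchwartzMap V ℂ := hcs.toSchwartzMap hcd
  have hkx : ∀ ξ, k ξ = (φ ξ : ℂ) * (𝓕 g) ξ := fun ξ => rfl
  have hkn : ∀ ξ, ‖k ξ‖ = φ ξ * ‖(𝓕 g) ξ‖ := fun ξ => by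
    rw [hkx, norm_mul, Complex.norm_real, Real.norm_of_nonneg (hφ0 ξ)]
  set h : SchwartzMap V ℂ := 𝓕⁻ k with hh
  have hFh : 𝓕 h = k := by rw [hh, FourierTransform.fourier_fourierInv_eq]
  set I := ∫ ξ, φ ξ * ‖(𝓕 g) ξ‖ ^ 2 with hIdef
  set W := ∫ ξ, φ ξ
  have hI0 : 0 ≤ I := integral_nonneg fun ξ => mul_nonneg (hφ0 ξ) (by positivity)
  have hW0 : 0 ≤ W := integral_nonneg hφ0
  have hφi : Integrable φ := hφs.continuous.integrable_of_hasCompactSupport hφc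
  have hφ2 : Integrable fun ξ => φ ξ * ‖(𝓕 g) ξ‖ ^ 2 :=
    (hφs.continuous.mul ((𝓕 g).continuous.norm.pow 2)).integrable_of_hasCompactSupport
      hφc.mul_right
  have hφ3 : Integrable fun ξ => φ ξ * ‖(𝓕 g) ξ‖ :=
    (hφs.continuous.mul (𝓕 g).continuous.norm).integrable_of_hasCompactSupport hφc.mul_right
  have hh2 : ∫ x, ‖h x‖ ^ 2 ≤ I := by
    rw [← SchwartzMap.integral_norm_sq_fourier, hFh]
    refine integral_mono k.integrable_norm_sq hφ2 fun ξ => ?_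
    simp only [hkn]
    have := mul_le_mul_of_nonneg_right (hφ1 ξ) (mul_nonneg (hφ0 ξ) (sq_nonneg ‖(𝓕 g) ξ‖))
    linarith
  have hM : ∀ x, ‖h x‖ ≤ √W * √I := fun x => by
    refine (k.norm_fourierInv_le_integral_norm x).trans ?_
    simp only [hkn]
    rw [← Real.sqrt_mul hW0]
    exact Real.le_sqrt_of_sq_le (sq_integral_mul_le_integral_mul_integral hφ0 hφi hφ3 hφ2)
  have hdual : I ≤ ∫ x, ‖g x‖ * ‖h x‖ := by
    have h1 := SchwartzMap.integral_inner_fourier_fourier g h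
    have h2 : ∫ ξ, inner ℂ ((𝓕 g) ξ) ((𝓕 h) ξ) = (I : ℂ) := by
      rw [hIdef, ← integral_complex_ofReal]
      refine integral_congr_ae (ae_of_all _ fun ξ => ?_)
      simp only [hFh, hkx]
      rw [← smul_eq_mul, inner_smul_right, inner_self_eq_norm_sq_to_K]
      push_cast
      rfl
    have h3 : I = ‖∫ x, inner ℂ (g x) (h x)‖ := by
      rw [← h1, h2, Complex.norm_real, Real.norm_of_nonneg hI0]
    rw [h3]
    refine (norm_integral_le_integral_norm _).trans_eq ?_
    refine integral_congr_ae (ae_of_all _ fun x => ?_)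
    simp [mul_comm]
  have hbound := integral_norm_mul_norm_le_of_bounded hp hθ hβ hpβ hθβ
    (g.memLp (ENNReal.ofReal p) volume) (h.memLp 2 volume) hM (by positivity)
  set N := (eLpNorm g (ENNReal.ofReal p) volume).toReal
  have hN : 0 ≤ N := ENNReal.toReal_nonneg
  rcases hI0.eq_or_lt with hI | hI
  · rw [← hI, Real.sqrt_zero]
    positivity
  have hs : 0 < √I := Real.sqrt_pos.2 hI
  have hIβ : (√I) ^ θ * I ^ β = √I := by
    nth_rewrite 2 [← Real.sq_sqrt hI0]
    rw [← Real.rpow_natCast, ← Real.rpow_mul hs.le, ← Real.rpow_add hs]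
    push_cast
    rw [hθβ, Real.rpow_one]
  refine le_of_mul_le_mul_right ?_ hs
  calc √I * √I = I := Real.mul_self_sqrt hI0
    _ ≤ N * (√W * √I) ^ θ * (∫ x, ‖h x‖ ^ 2) ^ β := hdual.trans hbound
    _ ≤ N * (√W * √I) ^ θ * I ^ β := by
      gcongr
    _ = N * √W ^ θ * ((√I) ^ θ * I ^ β) := by
      rw [Real.mul_rpow (by positivity) (by positivity)]; ring
    _ = N * √W ^ θ * √I := by rw [hIβ]

/-- Splitting the `L²` norm at frequency `R` with a cutoff equal to `1` on the ball of
radius `R`. -/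
lemma SchwartzMap.integral_norm_sq_le_add (g : SchwartzMap V ℂ) {φ : V → ℝ}
    (hφs : Continuous φ) (hφc : HasCompactSupport φ) (hφ0 : ∀ ξ, 0 ≤ φ ξ) {R s : ℝ} (hR : 0 < R)
    (hs : 0 < s) (hφR : ∀ ξ, ‖ξ‖ ≤ R → φ ξ = 1) :
    ∫ x, ‖g x‖ ^ 2 ≤ (∫ ξ, φ ξ * ‖(𝓕 g) ξ‖ ^ 2) +
      (R ^ (-s)) ^ 2 * ∫ ξ, ‖ξ‖ ^ (2 * s) * ‖(𝓕 g) ξ‖ ^ 2 := by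
  have hφ2 : Integrable fun ξ => φ ξ * ‖(𝓕 g) ξ‖ ^ 2 :=
    (hφs.mul ((𝓕 g).continuous.norm.pow 2)).integrable_of_hasCompactSupport hφc.mul_right
  have hH := ((𝓕 g).integrable_norm_rpow_mul_norm_sq (t := 2 * s) (by positivity)).const_mul
    ((R ^ (-s)) ^ 2)
  rw [← SchwartzMap.integral_norm_sq_fourier, ← integral_const_mul, ← integral_add hφ2 hH]
  refine integral_mono (𝓕 g).integrable_norm_sq (hφ2.add hH) fun ξ => ?_
  rcases le_total ‖ξ‖ R with hξ | hξ
  · rw [hφR ξ hξ, one_mul]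
    exact le_add_of_nonneg_right (by positivity)
  · have h1 : 1 ≤ (R ^ (-s)) ^ 2 * ‖ξ‖ ^ (2 * s) := by
      have h2 : (R ^ (-s)) ^ 2 * R ^ (2 * s) = 1 := by
        rw [← Real.rpow_natCast, ← Real.rpow_mul hR.le, ← Real.rpow_add hR]
        push_cast
        rw [show -s * 2 + 2 * s = 0 by ring, Real.rpow_zero]
      rw [← h2]
      gcongr
    have h3 := mul_le_mul_of_nonneg_right h1 (sq_nonneg ‖(𝓕 g) ξ‖)
    have h4 := mul_nonneg (hφ0 ξ) (sq_nonneg ‖(𝓕 g) ξ‖)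
    linarith

lemma SchwartzMap.toReal_eLpNorm_two (g : SchwartzMap V ℂ) :
    (eLpNorm g 2 volume).toReal = √(∫ x, ‖g x‖ ^ 2) := by
  rw [(g.memLp 2 volume).eLpNorm_eq_integral_rpow_norm two_ne_zero ENNReal.ofNat_ne_top,
    ENNReal.toReal_ofReal (by positivity)]
  simp [Real.sqrt_eq_rpow]

end Schwartz

/-- For d ≥ 1, α ∈ (0,1], s > 0, there is C > 0 such that for every Schwartz
function g : ℝ^d → ℂ and every R > 0,
‖g‖₂ ≤ C ( R^{αd/(2(2−α))} ‖g‖_{2−α} + R^{−s} (∫ |ξ|^{2s} |𝓕g(ξ)|² dξ)^{1/2} ). -/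
theorem stmt_5 (d : ℕ) (hd : 1 ≤ d) (α s : ℝ) (hα : 0 < α) (hα1 : α ≤ 1) (hs : 0 < s) :
    ∃ C > 0, ∀ g : SchwartzMap (EuclideanSpace ℝ (Fin d)) ℂ, ∀ R : ℝ, 0 < R →
      (eLpNorm (⇑g) 2 volume).toReal ≤
        C * (R ^ (α * d / (2 * (2 - α))) *
              (eLpNorm (⇑g) (ENNReal.ofReal (2 - α)) volume).toReal +
            R ^ (-s) *
              (∫ ξ : EuclideanSpace ℝ (Fin d), ‖ξ‖ ^ (2 * s) * ‖𝓕 (⇑g) ξ‖ ^ 2) ^ ((1 : ℝ) / 2)) := by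
  have hp : 0 < 2 - α := by linarith
  set θ := α / (2 - α) with hθ
  set A : ℝ := 2 ^ d * (volume : Measure (EuclideanSpace ℝ (Fin d))).real (Metric.ball 0 1)
    with hA
  have hA0 : 0 ≤ A := by positivity
  refine ⟨1 + √A ^ θ, by positivity, fun g R hR => ?_⟩
  let φ : ContDiffBump (0 : EuclideanSpace ℝ (Fin d)) := ⟨R, 2 * R, hR, by linarith⟩
  have hlow := sqrt_integral_mul_norm_fourier_sq_le g (φ := φ) φ.contDiff φ.hasCompactSupport
    (fun _ => φ.nonneg) (fun _ => φ.le_one) (p := 2 - α) (θ := θ) (β := (1 - α) / (2 - α))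
    hp (by positivity) (div_nonneg (by linarith) hp.le) (by field_simp; ring)
    (by rw [hθ]; field_simp; ring)
  have hsplit := g.integral_norm_sq_le_add φ.continuous φ.hasCompactSupport
    (fun _ => φ.nonneg) hR hs fun ξ hξ => φ.one_of_mem_closedBall (by simpa using hξ)
  have hW : ∫ ξ, φ ξ ≤ A * R ^ d := by
    refine (φ.integral_le_measure_closedBall volume).trans_eq ?_
    rw [Measure.addHaar_real_closedBall _ _ (by positivity)]
    simp only [finrank_euclideanSpace, Fintype.card_fin, hA, φ]
    ring
  have hWθ : √(∫ ξ, φ ξ) ^ θ ≤ √A ^ θ * R ^ (α * d / (2 * (2 - α))) := by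
    have h1 : R ^ (α * d / (2 * (2 - α))) = √(R ^ d) ^ θ := by
      rw [Real.sqrt_eq_rpow, ← Real.rpow_natCast, ← Real.rpow_mul hR.le, ← Real.rpow_mul hR.le]
      congr 1
      rw [hθ]
      field_simp
    rw [h1, ← Real.mul_rpow (by positivity) (by positivity), ← Real.sqrt_mul hA0]
    gcongr
  rw [← SchwartzMap.fourier_coe, ← Real.sqrt_eq_rpow, g.toReal_eLpNorm_two]
  set N := (eLpNorm g (ENNReal.ofReal (2 - α)) volume).toReal
  have hN : 0 ≤ N := ENNReal.toReal_nonneg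
  set H := ∫ ξ, ‖ξ‖ ^ (2 * s) * ‖(𝓕 g) ξ‖ ^ 2
  have hRs : 0 < R ^ (-s) := Real.rpow_pos_of_pos hR _
  have hRd : 0 < R ^ (α * d / (2 * (2 - α))) := Real.rpow_pos_of_pos hR _
  calc √(∫ x, ‖g x‖ ^ 2) ≤ √((∫ ξ, φ ξ * ‖(𝓕 g) ξ‖ ^ 2) + (R ^ (-s)) ^ 2 * H) :=
        Real.sqrt_le_sqrt hsplit
    _ ≤ √(∫ ξ, φ ξ * ‖(𝓕 g) ξ‖ ^ 2) + √((R ^ (-s)) ^ 2 * H) := by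
      have hP : 0 ≤ ∫ ξ, φ ξ * ‖(𝓕 g) ξ‖ ^ 2 :=
        integral_nonneg fun ξ => mul_nonneg φ.nonneg (sq_nonneg _)
      have hQ : 0 ≤ (R ^ (-s)) ^ 2 * H :=
        mul_nonneg (sq_nonneg _) (integral_nonneg fun ξ => by positivity)
      refine Real.sqrt_le_iff.2 ⟨by positivity, ?_⟩
      rw [add_sq, Real.sq_sqrt hP, Real.sq_sqrt hQ]
      have := mul_nonneg (Real.sqrt_nonneg (∫ ξ, φ ξ * ‖(𝓕 g) ξ‖ ^ 2))
        (Real.sqrt_nonneg ((R ^ (-s)) ^ 2 * H))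
      linarith
    _ ≤ N * (√A ^ θ * R ^ (α * d / (2 * (2 - α)))) + R ^ (-s) * √H := by
      rw [Real.sqrt_mul (by positivity), Real.sqrt_sq hRs.le]
      gcongr
      exact hlow.trans (by gcongr)
    _ ≤ (1 + √A ^ θ) * (R ^ (α * d / (2 * (2 - α))) * N + R ^ (-s) * √H) := by
      have h1 : 0 ≤ R ^ (α * d / (2 * (2 - α))) * N := by positivity
      have h2 : 0 ≤ √A ^ θ * (R ^ (-s) * √H) := by positivity
      linarith
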